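/- Let 1 ≤ p, q < ∞ and let (X,μ) be a probability space. There exists a constant C(p,q) > 0, depending only on p and q, such that for every f ∈ L_p(X,μ;ℂ) with ∫_X f dμ = 0 and every z ∈ ℂ, one has ‖M_{p,q}(f) − z‖_{L_q} ≥ C(p,q) ‖f‖_{L_p}^{p/q}. -/

import Mathlib

open MeasureTheory

universe u

/-- `sign z = z/|z|` for `z ≠ 0`, and `sign 0 = 0`. -/
noncomputable def csign (z : ℂ) : ℂ := if z = 0 then 0 else z / (‖z‖ : ℝ)

/-- The pointwise Mazur map `z ↦ sign(z) |z|^r`; applying it pointwise to `f ∈ L_p`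
gives the Mazur map `M_{p,q}(f) ∈ L_q` when `r = p/q`. -/
noncomputable def mazur (r : ℝ) (z : ℂ) : ℂ := csign z * ((‖z‖ ^ r : ℝ) : ℂ)


lemma csign_mul_aux (a b : ℂ) : csign (a * b) = csign a * csign b := by
  unfold csign
  by_cases ha : a = 0
  · simp [ha]
  by_cases hb : b = 0
  · simp [hb]
  simp only [ha, hb, mul_eq_zero, or_self, if_false, norm_mul, Complex.ofReal_mul]
  rw [div_mul_div_comm]

lemma mazur_mul_aux (r : ℝ) (a b : ℂ) : mazur r (a * b) = mazur r a * mazur r b := by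
  unfold mazur
  rw [csign_mul_aux, norm_mul, Real.mul_rpow (norm_nonneg _) (norm_nonneg _)]
  push_cast
  ring

lemma mazur_one_aux (r : ℝ) : mazur r 1 = 1 := by
  simp [mazur, csign]

lemma mazur_zero_aux (r : ℝ) : mazur r 0 = 0 := by
  simp [mazur, csign]

lemma norm_csign_aux {a : ℂ} (ha : a ≠ 0) : ‖csign a‖ = 1 := by
  have : ‖a‖ ≠ 0 := norm_ne_zero_iff.mpr ha
  simp [csign, ha]

lemma norm_mazur_aux {r : ℝ} (hr : 0 < r) (a : ℂ) : ‖mazur r a‖ = ‖a‖ ^ r := by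
  by_cases ha : a = 0
  · simp [ha, mazur, csign, Real.zero_rpow hr.ne']
  · unfold mazur
    rw [norm_mul, norm_csign_aux ha, one_mul, Complex.norm_real, Real.norm_eq_abs,
      abs_of_nonneg (by positivity)]

lemma mazur_ne_zero_aux {r : ℝ} (hr : 0 < r) {a : ℂ} (ha : a ≠ 0) : mazur r a ≠ 0 := by
  rw [← norm_ne_zero_iff, norm_mazur_aux hr]
  have : 0 < ‖a‖ := norm_pos_iff.mpr ha
  positivity

lemma mazur_mazur_aux {r s : ℝ} (hs : 0 < s) (hrs : s * r = 1) (a : ℂ) :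
    mazur r (mazur s a) = a := by
  by_cases ha : a = 0
  · simp [ha, mazur_zero_aux]
  have hn : ‖a‖ ≠ 0 := norm_ne_zero_iff.mpr ha
  have hm := mazur_ne_zero_aux hs ha
  have hpos : (0:ℝ) < ‖a‖ ^ s := by positivity
  have hpos' : ((‖a‖ ^ s : ℝ) : ℂ) ≠ 0 := by exact_mod_cast hpos.ne'
  have hn' : ((‖a‖ : ℝ) : ℂ) ≠ 0 := by exact_mod_cast hn
  have h1 : csign (mazur s a) = csign a := by
    have : csign (mazur s a) = mazur s a / (‖mazur s a‖ : ℝ) := by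
      rw [csign, if_neg hm]
    rw [this, norm_mazur_aux hs]
    unfold mazur
    field_simp
  have h2 : mazur r (mazur s a) = csign (mazur s a) * ((‖mazur s a‖ ^ r : ℝ) : ℂ) := rfl
  rw [h2, h1, norm_mazur_aux hs, ← Real.rpow_mul (norm_nonneg _), hrs, Real.rpow_one, csign,
    if_neg ha]
  field_simp

lemma measurable_mazur_aux (r : ℝ) : Measurable (mazur r) := by
  unfold mazur csign
  refine Measurable.mul (Measurable.ite (measurableSet_singleton 0) measurable_const ?_) ?_
  · fun_prop
  · fun_prop

lemma continuousAt_mazur_aux (s : ℝ) : ContinuousAt (mazur s) 1 := by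
  have h : ContinuousAt (fun z : ℂ => z / (‖z‖ : ℝ) * ((‖z‖ ^ s : ℝ) : ℂ)) 1 := by
    refine ContinuousAt.mul (ContinuousAt.div continuousAt_id (by fun_prop) (by simp)) ?_
    refine Complex.continuous_ofReal.continuousAt.comp ?_
    exact ContinuousAt.rpow_const (by fun_prop) (by simp)
  refine h.congr ?_
  filter_upwards [isOpen_ne.mem_nhds (one_ne_zero : (1:ℂ) ≠ 0)] with z hz
  have hz' : z ≠ 0 := hz
  simp [mazur, csign, hz']

lemma pointwise_aux {s : ℝ} (hs : 0 < s) :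
    ∃ K : ℝ, 0 < K ∧ ∀ a : ℂ, ‖mazur s a - 1‖ ≤ 1 / 2 + K * ‖a - 1‖ ^ s := by
  obtain ⟨δ, hδ, h⟩ := Metric.continuousAt_iff.mp (continuousAt_mazur_aux s) (1/2) (by norm_num)
  refine ⟨(1/δ + 1) ^ s + (1/δ) ^ s, by positivity, fun a => ?_⟩
  by_cases ha : ‖a - 1‖ < δ
  · have := h (x := a) (by rwa [dist_eq_norm])
    rw [mazur_one_aux, dist_eq_norm] at this
    have : 0 ≤ ((1/δ + 1) ^ s + (1/δ) ^ s) * ‖a - 1‖ ^ s := by positivity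
    linarith
  · push Not at ha
    have h1 : 1 ≤ 1/δ * ‖a - 1‖ := by
      rw [one_div, ← div_eq_inv_mul, le_div_iff₀ hδ]; linarith
    have h2 : ‖a‖ ≤ (1/δ + 1) * ‖a - 1‖ := by
      have := norm_add_le (a - 1) 1
      simp only [sub_add_cancel, norm_one] at this
      linarith
    have h3 : ‖a‖ ^ s ≤ (1/δ + 1) ^ s * ‖a - 1‖ ^ s := by
      rw [← Real.mul_rpow (by positivity) (by positivity)]
      exact Real.rpow_le_rpow (norm_nonneg _) h2 hs.le
    have h4 : 1 ≤ (1/δ) ^ s * ‖a - 1‖ ^ s := by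
      rw [← Real.mul_rpow (by positivity) (by positivity)]
      exact Real.one_le_rpow h1 hs.le
    have h5 := norm_sub_le (mazur s a) 1
    rw [norm_mazur_aux hs, norm_one] at h5
    linarith

lemma main_aux {p q : ℝ} (hp : 1 ≤ p) (hq : 1 ≤ q) :
    ∃ c : ℝ, 0 < c ∧
      ∀ (X : Type u) [MeasurableSpace X] (μ : Measure X) [IsProbabilityMeasure μ]
        (f : X → ℂ), MemLp f (ENNReal.ofReal p) μ → (∫ x, f x ∂μ) = 0 →
        ∀ z : ℂ, z ≠ 0 →
          ENNReal.ofReal c * ‖z‖ₑ ≤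
            eLpNorm (fun x => mazur (p / q) (f x) - z) (ENNReal.ofReal q) μ := by
  have hp0 : 0 < p := by linarith
  have hq0 : 0 < q := by linarith
  set r := p / q with hr
  set s := q / p with hs
  have hr0 : 0 < r := by positivity
  have hs0 : 0 < s := by positivity
  have hsr : s * r = 1 := by rw [hr, hs]; field_simp
  have hrs : r * s = 1 := by rw [hr, hs]; field_simp
  have hsq : s ≤ q := div_le_self hq0.le hp
  obtain ⟨K, hK, hpt⟩ := pointwise_aux hs0
  refine ⟨(1 / (2 * K)) ^ (1 / s), by positivity, ?_⟩
  intro X _ μ _ f hf hf0 z hz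
  set w := mazur s z with hw
  have hw0 : w ≠ 0 := mazur_ne_zero_aux hs0 hz
  have hwz : mazur r w = z := mazur_mazur_aux hs0 hsr z
  have hint : Integrable f μ := hf.integrable (by simpa using ENNReal.ofReal_le_ofReal hp)
  have hgm : AEStronglyMeasurable (fun x => mazur r (f x)) μ :=
    ((measurable_mazur_aux r).comp_aemeasurable hf.1.aemeasurable).aestronglyMeasurable
  set h : X → ℂ := fun x => mazur r (f x) / z - 1 with hh
  have hhm : AEStronglyMeasurable h μ := by
    have := (hgm.const_mul z⁻¹).sub (aestronglyMeasurable_const (b := (1:ℂ)))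
    refine this.congr (Filter.Eventually.of_forall fun x => ?_)
    simp [hh, div_eq_inv_mul]
  have hgz : (fun x => mazur r (f x) - z) = z • h := by
    ext x
    simp [hh]
    field_simp
  rw [hgz, eLpNorm_const_smul, mul_comm]
  gcongr
  by_contra hlt
  push Not at hlt
  -- pointwise bound
  have hpt' : ∀ x, ‖w⁻¹ * f x - 1‖ₑ ≤ ENNReal.ofReal (1/2) + ENNReal.ofReal K * ‖h x‖ₑ ^ s := by
    intro x
    have e1 : mazur s (mazur r (f x) / z) = w⁻¹ * f x := by
      have : mazur r (f x) / z = mazur r (w⁻¹ * f x) := by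
        rw [div_eq_iff hz]
        conv_rhs => rw [← hwz]
        rw [← mazur_mul_aux]
        congr 1
        field_simp
      rw [this, mazur_mazur_aux hr0 hrs]
    have := hpt (mazur r (f x) / z)
    rw [e1] at this
    rw [← ofReal_norm_eq_enorm, ← ofReal_norm_eq_enorm, ENNReal.ofReal_rpow_of_nonneg (norm_nonneg _) hs0.le,
      ← ENNReal.ofReal_mul hK.le, ← ENNReal.ofReal_add (by norm_num) (by positivity)]
    exact ENNReal.ofReal_le_ofReal this
  have hI : ∫ x, (w⁻¹ * f x - 1) ∂μ = -1 := by
    rw [integral_sub (hint.const_mul _) (integrable_const _), integral_const_mul, hf0]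
    simp
  have h1 : (1 : ENNReal) ≤ ∫⁻ x, ‖w⁻¹ * f x - 1‖ₑ ∂μ := by
    have := enorm_integral_le_lintegral_enorm (μ := μ) (fun x => w⁻¹ * f x - 1)
    rw [hI] at this
    simpa using this
  have h2 : ∫⁻ x, ‖w⁻¹ * f x - 1‖ₑ ∂μ ≤
      ENNReal.ofReal (1/2) + ENNReal.ofReal K * ∫⁻ x, ‖h x‖ₑ ^ s ∂μ := by
    refine (lintegral_mono hpt').trans ?_
    rw [lintegral_add_left measurable_const, lintegral_const_mul' _ _ ENNReal.ofReal_ne_top]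
    simp
  have h3 : ∫⁻ x, ‖h x‖ₑ ^ s ∂μ = eLpNorm h (ENNReal.ofReal s) μ ^ s := by
    rw [eLpNorm_eq_lintegral_rpow_enorm_toReal (by simpa using hs0) ENNReal.ofReal_ne_top,
      ENNReal.toReal_ofReal hs0.le, ← ENNReal.rpow_mul, one_div, inv_mul_cancel₀ hs0.ne',
      ENNReal.rpow_one]
  have h4 : eLpNorm h (ENNReal.ofReal s) μ ≤ eLpNorm h (ENNReal.ofReal q) μ :=
    eLpNorm_le_eLpNorm_of_exponent_le (ENNReal.ofReal_le_ofReal hsq) hhm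
  have h5 : eLpNorm h (ENNReal.ofReal s) μ ^ s < ENNReal.ofReal (1 / (2 * K)) := by
    have := ENNReal.rpow_lt_rpow (h4.trans_lt hlt) hs0
    rwa [ENNReal.ofReal_rpow_of_nonneg (by positivity) hs0.le, ← Real.rpow_mul (by positivity),
      one_div s, inv_mul_cancel₀ hs0.ne', Real.rpow_one] at this
  have h6 : ENNReal.ofReal K * eLpNorm h (ENNReal.ofReal s) μ ^ s < ENNReal.ofReal (1/2) := by
    have : ENNReal.ofReal (1/2) = ENNReal.ofReal K * ENNReal.ofReal (1 / (2 * K)) := by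
      rw [← ENNReal.ofReal_mul hK.le]; congr 1; field_simp
    rw [this]
    exact ENNReal.mul_lt_mul_right (by simpa using hK) ENNReal.ofReal_ne_top h5
  have h7 := h1.trans h2
  rw [h3] at h7
  have h8 : ENNReal.ofReal (1/2) + ENNReal.ofReal K * eLpNorm h (ENNReal.ofReal s) μ ^ s < 1 := by
    calc _ < ENNReal.ofReal (1/2) + ENNReal.ofReal (1/2) :=
          ENNReal.add_lt_add_left ENNReal.ofReal_ne_top h6
      _ = 1 := by rw [← ENNReal.ofReal_add (by norm_num) (by norm_num)]; norm_num
  exact absurd h7 (not_le.mpr h8)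

theorem stmt11 {p q : ℝ} (hp : 1 ≤ p) (hq : 1 ≤ q) :
    ∃ C : ℝ, 0 < C ∧
      ∀ (X : Type u) [MeasurableSpace X] (μ : Measure X) [IsProbabilityMeasure μ]
        (f : X → ℂ), MemLp f (ENNReal.ofReal p) μ → (∫ x, f x ∂μ) = 0 →
        ∀ z : ℂ,
          ENNReal.ofReal C * (eLpNorm f (ENNReal.ofReal p) μ) ^ (p / q) ≤
            eLpNorm (fun x => mazur (p / q) (f x) - z) (ENNReal.ofReal q) μ := by
  obtain ⟨c, hc, H⟩ := main_aux.{u} hp hq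
  have hp0 : 0 < p := by linarith
  have hq0 : 0 < q := by linarith
  have hr0 : 0 < p / q := by positivity
  refine ⟨c / (c + 1), by positivity, ?_⟩
  intro X _ μ _ f hf hf0 z
  have hE : ENNReal.ofReal c * ‖z‖ₑ ≤
      eLpNorm (fun x => mazur (p / q) (f x) - z) (ENNReal.ofReal q) μ := by
    by_cases hz : z = 0
    · simp [hz]
    · exact H X μ f hf hf0 z hz
  have hgm : AEStronglyMeasurable (fun x => mazur (p / q) (f x)) μ :=
    ((measurable_mazur_aux _).comp_aemeasurable hf.1.aemeasurable).aestronglyMeasurable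
  have hnorm : (eLpNorm f (ENNReal.ofReal p) μ) ^ (p / q) =
      eLpNorm (fun x => mazur (p / q) (f x)) (ENNReal.ofReal q) μ := by
    rw [eLpNorm_eq_lintegral_rpow_enorm_toReal (by simpa using hp0) ENNReal.ofReal_ne_top,
      eLpNorm_eq_lintegral_rpow_enorm_toReal (by simpa using hq0) ENNReal.ofReal_ne_top,
      ENNReal.toReal_ofReal hp0.le, ENNReal.toReal_ofReal hq0.le, ← ENNReal.rpow_mul]
    congr 1
    · refine lintegral_congr fun x => ?_
      have : ‖mazur (p / q) (f x)‖ₑ = ‖f x‖ₑ ^ (p / q) := by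
        rw [← ofReal_norm_eq_enorm, ← ofReal_norm_eq_enorm, norm_mazur_aux hr0,
          ENNReal.ofReal_rpow_of_nonneg (norm_nonneg _) hr0.le]
      rw [this, ← ENNReal.rpow_mul]
      congr 1
      field_simp
    · field_simp
  rw [hnorm]
  set E := eLpNorm (fun x => mazur (p / q) (f x) - z) (ENNReal.ofReal q) μ with hEdef
  have htri : eLpNorm (fun x => mazur (p / q) (f x)) (ENNReal.ofReal q) μ ≤ E + ‖z‖ₑ := by
    have h := eLpNorm_add_le (μ := μ) (p := ENNReal.ofReal q)
      (hgm.sub (aestronglyMeasurable_const (b := z)))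
      (aestronglyMeasurable_const (b := z)) (by simpa using ENNReal.ofReal_le_ofReal hq)
    have e : ((fun x => mazur (p / q) (f x)) - (fun _ => z)) + (fun _ => z) =
        fun x => mazur (p / q) (f x) := by
      ext x; simp
    rw [e, eLpNorm_const z (by simpa using hq0) (IsProbabilityMeasure.ne_zero μ)] at h
    simp only [measure_univ, ENNReal.one_rpow, mul_one] at h
    exact h
  have hcc : ENNReal.ofReal (c / (c + 1)) = ENNReal.ofReal (1 / (c + 1)) * ENNReal.ofReal c := by
    rw [← ENNReal.ofReal_mul (by positivity)]; congr 1; field_simp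
  calc _ ≤ ENNReal.ofReal (c / (c + 1)) * (E + ‖z‖ₑ) := by gcongr
    _ = ENNReal.ofReal (1 / (c + 1)) * (ENNReal.ofReal c * E + ENNReal.ofReal c * ‖z‖ₑ) := by
      rw [hcc]; ring
    _ ≤ ENNReal.ofReal (1 / (c + 1)) * (ENNReal.ofReal c * E + E) := by gcongr
    _ = (ENNReal.ofReal (1 / (c + 1)) * (ENNReal.ofReal c + ENNReal.ofReal 1)) * E := by
      rw [ENNReal.ofReal_one]; ring
    _ = E := by
      rw [← ENNReal.ofReal_add hc.le (by norm_num), ← ENNReal.ofReal_mul (by positivity),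
        one_div, inv_mul_cancel₀ (by positivity), ENNReal.ofReal_one, one_mul]
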